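/- If the double complex (A, d', d'') satisfies the d'd''-lemma and the spectral sequence {E^{p,q}_r} induced by A does not degenerate at E_0 (i.e. it is not the case that d_s = 0 for all integers p, q and all s ≥ 0), then it degenerates at E_1 (i.e. d_s = 0 for all integers p, q and all integers s ≥ 1). -/

import Mathlib

open Submodule

/-- A double complex of `k`-vector spaces: `A = ⊕_{p,q ∈ ℤ} A^{p,q}` with `A^{p,q} = 0`
for `p < 0` or `q < 0`, with anticommuting differentials `d' : A^{p,q} → A^{p+1,q}` and
`d'' : A^{p,q} → A^{p,q+1}` squaring to zero. -/
structure DoubleComplex (k : Type*) [Field k] (V : Type*) [AddCommGroup V] [Module k V] where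
  A : ℤ → ℤ → Submodule k V
  isInternal : DirectSum.IsInternal (fun pq : ℤ × ℤ => A pq.1 pq.2)
  vanish : ∀ p q : ℤ, p < 0 ∨ q < 0 → A p q = ⊥
  d' : V →ₗ[k] V
  d'' : V →ₗ[k] V
  mapA_d' : ∀ p q : ℤ, (A p q).map d' ≤ A (p + 1) q
  mapA_d'' : ∀ p q : ℤ, (A p q).map d'' ≤ A p (q + 1)
  d'_d' : d' ∘ₗ d' = 0
  d''_d'' : d'' ∘ₗ d'' = 0
  anticomm : d' ∘ₗ d'' + d'' ∘ₗ d' = 0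

namespace DoubleComplex

variable {k : Type*} [Field k] {V : Type*} [AddCommGroup V] [Module k V]
variable (C : DoubleComplex k V)

/-- The total differential `d = d' + d''`. -/
def dTot : V →ₗ[k] V := C.d' + C.d''

lemma dd_apply (x : V) : C.dTot (C.dTot x) = 0 := by
  have h1 := LinearMap.ext_iff.mp C.d'_d' x
  have h2 := LinearMap.ext_iff.mp C.d''_d'' x
  have h3 := LinearMap.ext_iff.mp C.anticomm x
  simp only [LinearMap.comp_apply, LinearMap.zero_apply, LinearMap.add_apply] at h1 h2 h3
  simp only [dTot, LinearMap.add_apply, map_add]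
  rw [h1, h2, zero_add, add_zero, add_comm]
  exact h3

/-- The filtration `F^p A^n = ⊕_{s ≥ p} A^{s, n-s}`. -/
def F (p n : ℤ) : Submodule k V := ⨆ (s : ℤ) (_ : p ≤ s), C.A s (n - s)

lemma F_antitone {p p' : ℤ} (h : p ≤ p') (n : ℤ) : C.F p' n ≤ C.F p n :=
  biSup_mono fun s hs => le_trans h hs

/-- `Z^{p,q}_r = {ξ ∈ F^p A^{p+q} : dξ ∈ F^{p+r} A^{p+q+1}}`. -/
def Z (p q r : ℤ) : Submodule k V :=
  C.F p (p + q) ⊓ (C.F (p + r) (p + q + 1)).comap C.dTot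

/-- `Z^{p,q}_∞ = F^p A^{p+q} ∩ ker d`. -/
def Zinf (p q : ℤ) : Submodule k V := C.F p (p + q) ⊓ LinearMap.ker C.dTot

/-- `B^{p,q}_r = F^p A^{p+q} ∩ d(F^{p-r} A^{p+q-1})`. -/
def B (p q r : ℤ) : Submodule k V :=
  C.F p (p + q) ⊓ (C.F (p - r) (p + q - 1)).map C.dTot

/-- `B^{p,q}_∞ = F^p A^{p+q} ∩ im d`. -/
def Binf (p q : ℤ) : Submodule k V := C.F p (p + q) ⊓ LinearMap.range C.dTot

lemma B_mono (p q : ℤ) {r r' : ℤ} (h : r ≤ r') : C.B p q r ≤ C.B p q r' :=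
  inf_le_inf le_rfl (Submodule.map_mono (C.F_antitone (by omega) _))

lemma Z_anti (p q : ℤ) {r r' : ℤ} (h : r' ≤ r) : C.Z p q r ≤ C.Z p q r' :=
  inf_le_inf le_rfl (Submodule.comap_mono (C.F_antitone (by omega) _))

/-- The denominator `Z^{p+1,q-1}_{r-1} + B^{p,q}_{r-1}` of `E^{p,q}_r`. -/
def Eden (p q r : ℤ) : Submodule k V := C.Z (p + 1) (q - 1) (r - 1) ⊔ C.B p q (r - 1)

/-- `E^{p,q}_r = Z^{p,q}_r / (Z^{p+1,q-1}_{r-1} + B^{p,q}_{r-1})`. -/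
abbrev E (p q r : ℤ) :=
  C.Z p q r ⧸ (C.Eden p q r).comap (C.Z p q r).subtype

/-- The common target `Z^{p,q}_r / (Z^{p+1,q-1}_{r-1} + B^{p,q}_r)` of `α_{p,q,r}` and
`β_{p,q,r}`. -/
abbrev T (p q r : ℤ) :=
  C.Z p q r ⧸ (C.Z (p + 1) (q - 1) (r - 1) ⊔ C.B p q r).comap (C.Z p q r).subtype

/-- `β_{p,q,r} : E^{p,q}_r → Z^{p,q}_r/(Z^{p+1,q-1}_{r-1} + B^{p,q}_r)`, induced by the
identity of `Z^{p,q}_r`. -/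
def beta (p q r : ℤ) : C.E p q r →ₗ[k] C.T p q r :=
  Submodule.mapQ _ _ LinearMap.id (by
    intro x hx
    simp only [Submodule.mem_comap, LinearMap.id_coe, id_eq] at hx ⊢
    exact sup_le_sup_left (C.B_mono p q (by omega)) _ hx)

/-- `α_{p,q,r} : E^{p,q}_{r+1} → Z^{p,q}_r/(Z^{p+1,q-1}_{r-1} + B^{p,q}_r)`, induced by the
inclusion `Z^{p,q}_{r+1} ⊆ Z^{p,q}_r`. -/
def alpha (p q r : ℤ) : C.E p q (r + 1) →ₗ[k] C.T p q r :=
  Submodule.mapQ _ _ (Submodule.inclusion (C.Z_anti p q (by omega : r ≤ r + 1))) (by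
    rw [← Submodule.comap_comp, Submodule.subtype_comp_inclusion]
    exact Submodule.comap_mono
      (sup_le_sup (C.Z_anti _ _ (by omega)) (C.B_mono _ _ (by omega))))

lemma d_Z (p q r : ℤ) : ∀ x ∈ C.Z p q r, C.dTot x ∈ C.Z (p + r) (q - r + 1) r := by
  intro x hx
  rw [Z, Submodule.mem_inf] at hx ⊢
  obtain ⟨hx1, hx2⟩ := hx
  constructor
  · rw [show p + r + (q - r + 1) = p + q + 1 by ring]
    exact hx2
  · rw [Submodule.mem_comap, C.dd_apply]
    exact zero_mem _

lemma d_Eden (p q r : ℤ) : ∀ x ∈ C.Eden p q r, C.dTot x ∈ C.Eden (p + r) (q - r + 1) r := by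
  intro x hx
  rw [Eden, Submodule.mem_sup] at hx
  obtain ⟨y, hy, z, hz, rfl⟩ := hx
  rw [map_add]
  apply add_mem
  · apply Submodule.mem_sup_right
    rw [Z, Submodule.mem_inf] at hy
    obtain ⟨hy1, hy2⟩ := hy
    rw [Submodule.mem_comap] at hy2
    rw [B, Submodule.mem_inf]
    have e1 : (p + 1 + (r - 1) : ℤ) = p + r := by ring
    have e2 : (p + 1 + (q - 1) + 1 : ℤ) = p + r + (q - r + 1) := by ring
    have e3 : (p + 1 + (q - 1) : ℤ) = p + r + (q - r + 1) - 1 := by ring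
    rw [e1, e2] at hy2
    rw [e3] at hy1
    refine ⟨hy2, ?_⟩
    rw [show (p + r - (r - 1) : ℤ) = p + 1 by ring]
    exact Submodule.mem_map_of_mem hy1
  · rw [B, Submodule.mem_inf] at hz
    obtain ⟨hz1, hz2⟩ := hz
    rw [Submodule.mem_map] at hz2
    obtain ⟨w, hw, rfl⟩ := hz2
    rw [C.dd_apply]
    exact zero_mem _

/-- The restriction of the total differential to `Z^{p,q}_r → Z^{p+r,q-r+1}_r`. -/
def drAux (p q r : ℤ) : C.Z p q r →ₗ[k] C.Z (p + r) (q - r + 1) r :=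
  C.dTot.restrict (C.d_Z p q r)

/-- The induced differential `d_r : E^{p,q}_r → E^{p+r,q-r+1}_r`. -/
def dr (p q r : ℤ) : C.E p q r →ₗ[k] C.E (p + r) (q - r + 1) r :=
  Submodule.mapQ _ _ (C.drAux p q r) (by
    rw [drAux, ← Submodule.comap_comp, LinearMap.subtype_comp_restrict]
    show (C.Eden p q r).comap (C.Z p q r).subtype ≤
      (C.Eden (p + r) (q - r + 1) r).comap (C.dTot ∘ₗ (C.Z p q r).subtype)
    rw [Submodule.comap_comp]
    exact Submodule.comap_mono fun x hx => C.d_Eden p q r x hx)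

/-- The set `ℰ^{p,q}_r`: for `r ≥ 1` it consists of the elements
`ξ = ξ_0 + ⋯ + ξ_{r-1}` with `ξ_i ∈ A^{p+i,q-i}` such that `dξ = d'ξ_{r-1}`,
`d'ξ_{r-1} ∉ im d''`, and `ξ_0` is not the leading term of any `d`-closed element
(no `d`-closed `η ∈ F^p A^{p+q}` has component `ξ_0` in `A^{p,q}`, i.e. `η - ξ_0 ∈ F^{p+1}`);
and `ℰ^{p,q}_0 = B^{p,q+1}_0 \ (Z^{p+1,q}_{-1} + B^{p,q+1}_{-1})`. -/
def scrE (p q r : ℤ) : Set V :=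
  if 1 ≤ r then
    {ξ | ∃ c : ℕ → V, (∀ i : ℕ, c i ∈ C.A (p + i) (q - i)) ∧
        ξ = ∑ i ∈ Finset.range r.toNat, c i ∧
        C.dTot ξ = C.d' (c (r.toNat - 1)) ∧
        C.d' (c (r.toNat - 1)) ∉ LinearMap.range C.d'' ∧
        ¬∃ η, η ∈ C.F p (p + q) ∧ C.dTot η = 0 ∧ η - c 0 ∈ C.F (p + 1) (p + q)}
  else
    (C.B p (q + 1) 0 : Set V) \ ((C.Z (p + 1) q (-1) ⊔ C.B p (q + 1) (-1) : Submodule k V) : Set V)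

/-- The double complex satisfies the `d'd''`-lemma:
`im d' ∩ ker d'' ∩ A^{p,q} = ker d' ∩ im d'' ∩ A^{p,q} = im (d'd'') ∩ A^{p,q}` for all `p, q`. -/
def DDLemma : Prop :=
  ∀ p q : ℤ,
    LinearMap.range C.d' ⊓ LinearMap.ker C.d'' ⊓ C.A p q
        = LinearMap.ker C.d' ⊓ LinearMap.range C.d'' ⊓ C.A p q ∧
      LinearMap.range C.d' ⊓ LinearMap.ker C.d'' ⊓ C.A p q
        = LinearMap.range (C.d' ∘ₗ C.d'') ⊓ C.A p q

/-- The projection of `V` onto the component `A^{p,q}`. -/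
noncomputable def proj (pq : ℤ × ℤ) : V →ₗ[k] V :=
  (C.A pq.1 pq.2).subtype ∘ₗ
    DirectSum.component k (ℤ × ℤ) (fun i : ℤ × ℤ => C.A i.1 i.2) pq ∘ₗ
      (LinearEquiv.ofBijective
        (DirectSum.coeLinearMap fun i : ℤ × ℤ => C.A i.1 i.2) C.isInternal).symm.toLinearMap

lemma proj_mem (pq : ℤ × ℤ) (x : V) : C.proj pq x ∈ C.A pq.1 pq.2 :=
  Submodule.coe_mem _

lemma ofBijective_symm_of_mem {i : ℤ × ℤ} {x : V} (hx : x ∈ C.A i.1 i.2) :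
    (LinearEquiv.ofBijective
      (DirectSum.coeLinearMap fun i : ℤ × ℤ => C.A i.1 i.2) C.isInternal).symm x =
      DirectSum.lof k (ℤ × ℤ) (fun i : ℤ × ℤ => C.A i.1 i.2) i ⟨x, hx⟩ := by
  exact (LinearEquiv.symm_apply_eq _).mpr
    (DirectSum.coeLinearMap_lof (fun i : ℤ × ℤ => C.A i.1 i.2) i ⟨x, hx⟩).symm

lemma proj_of_mem {i : ℤ × ℤ} {x : V} (hx : x ∈ C.A i.1 i.2) : C.proj i x = x := by
  simp only [proj, LinearMap.comp_apply, LinearEquiv.coe_coe, C.ofBijective_symm_of_mem hx,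
    DirectSum.component.lof_self, Submodule.subtype_apply]

lemma proj_of_mem_ne {i j : ℤ × ℤ} (hij : i ≠ j) {x : V} (hx : x ∈ C.A i.1 i.2) :
    C.proj j x = 0 := by
  simp only [proj, LinearMap.comp_apply, LinearEquiv.coe_coe, C.ofBijective_symm_of_mem hx,
    DirectSum.component.of, dif_neg hij, map_zero]

/-- A linear map which is homogeneous along an injective reindexing commutes with the
projections. -/
lemma proj_map {f : V →ₗ[k] V} {σ : ℤ × ℤ → ℤ × ℤ} (hσ : σ.Injective)
    (hf : ∀ i, ∀ x ∈ C.A i.1 i.2, f x ∈ C.A (σ i).1 (σ i).2) (i : ℤ × ℤ) (x : V) :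
    C.proj (σ i) (f x) = f (C.proj i x) := by
  have hx : x ∈ ⨆ i : ℤ × ℤ, C.A i.1 i.2 := by
    rw [C.isInternal.submodule_iSup_eq_top]
    exact Submodule.mem_top
  induction hx using Submodule.iSup_induction' with
  | mem j y hy =>
    by_cases hji : j = i
    · subst hji
      rw [C.proj_of_mem hy, C.proj_of_mem (hf j y hy)]
    · rw [C.proj_of_mem_ne hji hy, C.proj_of_mem_ne (hσ.ne hji) (hf j y hy), map_zero]
  | zero => simp only [map_zero]
  | add y z _ _ hy hz => simp only [map_add, hy, hz]

lemma d'_mem {p q : ℤ} {x : V} (hx : x ∈ C.A p q) : C.d' x ∈ C.A (p + 1) q :=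
  C.mapA_d' p q (Submodule.mem_map_of_mem hx)

lemma d''_mem {p q : ℤ} {x : V} (hx : x ∈ C.A p q) : C.d'' x ∈ C.A p (q + 1) :=
  C.mapA_d'' p q (Submodule.mem_map_of_mem hx)

lemma d'_d'_apply (x : V) : C.d' (C.d' x) = 0 := LinearMap.congr_fun C.d'_d' x

lemma d'_d''_apply (x : V) : C.d' (C.d'' x) = -C.d'' (C.d' x) :=
  eq_neg_of_add_eq_zero_left (LinearMap.congr_fun C.anticomm x)

lemma A_le_F {p s n t : ℤ} (hs : p ≤ s) (hst : s + t = n) : C.A s t ≤ C.F p n := by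
  obtain rfl : t = n - s := by omega
  exact le_iSup₂_of_le s hs le_rfl

lemma F_le_A_sup_F (p n : ℤ) : C.F p n ≤ C.A p (n - p) ⊔ C.F (p + 1) n := by
  refine iSup₂_le fun s hs => ?_
  rcases hs.eq_or_lt with rfl | hlt
  · exact le_sup_left
  · exact le_sup_of_le_right (C.A_le_F (by omega) (by omega))

lemma dTot_mem_F {p n : ℤ} {x : V} (hx : x ∈ C.F p n) : C.dTot x ∈ C.F p (n + 1) := by
  suffices h : C.F p n ≤ (C.F p (n + 1)).comap C.dTot from h hx
  refine iSup₂_le fun s hs y hy => ?_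
  exact add_mem (C.A_le_F (by omega) (by omega) (C.d'_mem hy))
    (C.A_le_F hs (by omega) (C.d''_mem hy))

lemma eq_zero_of_mem_A_of_mem_F {p t n : ℤ} {x : V} (hA : x ∈ C.A p t)
    (hF : x ∈ C.F (p + 1) n) : x = 0 := by
  have hle : C.F (p + 1) n ≤ LinearMap.ker (C.proj (p, t)) := by
    refine iSup₂_le fun s hs y hy => ?_
    have hne : ((s, n - s) : ℤ × ℤ) ≠ (p, t) := fun h => by
      have := congrArg Prod.fst h
      simp only at this
      omega
    exact C.proj_of_mem_ne hne hy
  rw [← C.proj_of_mem (i := (p, t)) hA]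
  exact hle hF

/-- Under the `d'd''`-lemma, the total differential of an element of `A^{p,q}` killed by `d''`
is the total differential of an element of `A^{p+1,q-1}`. -/
lemma DDLemma.exists_dTot_eq {C : DoubleComplex k V} (hdd : C.DDLemma) {p q : ℤ} {x : V}
    (hx : x ∈ C.A p q) (hx0 : C.d'' x = 0) :
    ∃ y ∈ C.A (p + 1) (q - 1), C.dTot y = C.dTot x := by
  have hmem : C.d' x ∈ LinearMap.range C.d' ⊓ LinearMap.ker C.d'' ⊓ C.A (p + 1) q := by
    refine ⟨⟨⟨x, rfl⟩, ?_⟩, C.d'_mem hx⟩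
    refine LinearMap.mem_ker.mpr ?_
    rw [← neg_eq_zero, ← C.d'_d''_apply, hx0, map_zero]
  rw [(hdd (p + 1) q).2] at hmem
  obtain ⟨⟨η, hη⟩, hA⟩ := hmem
  have hσ : Function.Injective (fun i : ℤ × ℤ => ((i.1 + 1, i.2 + 1) : ℤ × ℤ)) := by
    rintro ⟨a, b⟩ ⟨c, d⟩ h
    simpa using h
  have hcomm := C.proj_map (f := C.d' ∘ₗ C.d'') hσ
    (fun i y hy => C.d'_mem (C.d''_mem hy)) (p, q - 1) η
  simp only [sub_add_cancel, hη] at hcomm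
  rw [C.proj_of_mem (i := (p + 1, q)) hA] at hcomm
  refine ⟨-C.d' (C.proj (p, q - 1) η), neg_mem (C.d'_mem (C.proj_mem (p, q - 1) η)), ?_⟩
  simp only [dTot, LinearMap.add_apply, map_neg, hx0, d'_d'_apply, zero_add, add_zero,
    hcomm, LinearMap.comp_apply, d'_d''_apply]

/-- Under the `d'd''`-lemma, the total differential maps `Z^{p,q}_r` into
`B^{p+r,q-r+1}_{r-1}` for `r ≥ 1`. -/
lemma DDLemma.dTot_mem_B {C : DoubleComplex k V} (hdd : C.DDLemma) {p q r : ℤ} (hr : 1 ≤ r)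
    {x : V} (hx : x ∈ C.Z p q r) : C.dTot x ∈ C.B (p + r) (q - r + 1) (r - 1) := by
  refine ⟨(C.d_Z p q r x hx).1, ?_⟩
  obtain ⟨hxF, hdx⟩ := hx
  rw [show p + r - (r - 1) = p + 1 by ring, show p + r + (q - r + 1) - 1 = p + q by ring]
  obtain ⟨ξ, hξ, y, hy, rfl⟩ := Submodule.mem_sup.mp (C.F_le_A_sup_F p (p + q) hxF)
  rw [add_sub_cancel_left] at hξ
  have hξ0 : C.d'' ξ = 0 := by
    refine C.eq_zero_of_mem_A_of_mem_F (n := p + q + 1) (C.d''_mem hξ) ?_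
    have hsplit : C.d'' ξ = C.dTot (ξ + y) - C.dTot y - C.d' ξ := by
      simp only [dTot, LinearMap.add_apply, map_add]
      abel
    rw [hsplit]
    exact sub_mem (sub_mem (C.F_antitone (by omega) _ hdx) (C.dTot_mem_F hy))
      (C.A_le_F le_rfl (by omega) (C.d'_mem hξ))
  obtain ⟨z, hz, hdz⟩ := hdd.exists_dTot_eq hξ hξ0
  exact ⟨z + y, add_mem (C.A_le_F le_rfl (by omega) hz) hy, by rw [map_add, map_add, hdz]⟩

theorem statement_15 (hdd : C.DDLemma)
    (h0 : ¬∀ p q s : ℤ, 0 ≤ s → C.dr p q s = 0) :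
    ∀ p q s : ℤ, 1 ≤ s → C.dr p q s = 0 := by
  intro p q s hs
  refine LinearMap.ext fun x => ?_
  obtain ⟨x, rfl⟩ := Submodule.mkQ_surjective _ x
  exact (Submodule.Quotient.mk_eq_zero _).mpr
    (Submodule.mem_sup_right (hdd.dTot_mem_B hs x.2))

end DoubleComplex
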